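/- Let N be a homogeneous quasi-norm on the step-2 group, smooth away from the origin and satisfying Condition (G) with index j₀ and integer γ ≥ 2. Let p ≥ 2γ, let q = p/(p−1) be the conjugate exponent of p, and let a > 0. Then there exist constants A > 0 and B ≥ 0 such that for every smooth compactly supported f : ℝ^{n₁}×ℝⁿ → ℝ, ∫ |f(z)|^q N(z)^{p−2γ} |x_{j₀}|^{2γ} dμ_p(z) ≤ A ∫ |∇_G f(z)|^q dμ_p(z) + B ∫ |f(z)|^q dμ_p(z), where z = (x,t). -/

import Mathlib

open Real Finset Matrix MeasureTheory

/-- The generating vector fields `X_j` of a step-2 Carnot group on `ℝ^{n₁} × ℝⁿ` defined by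
skew-symmetric matrices `B⁽ᵏ⁾`:
`X_j f(x,t) = ∂_{x_j} f(x,t) + (1/2) Σ_k Σ_i B⁽ᵏ⁾_{ij} x_i ∂_{t_k} f(x,t)`. -/
noncomputable def Xvf {n₁ n : ℕ} (B : Fin n → Matrix (Fin n₁) (Fin n₁) ℝ) (j : Fin n₁)
    (f : (Fin n₁ → ℝ) × (Fin n → ℝ) → ℝ) (z : (Fin n₁ → ℝ) × (Fin n → ℝ)) : ℝ :=
  fderiv ℝ f z (Pi.single j 1, 0) +
    (1 / 2) * ∑ k : Fin n, (∑ i : Fin n₁, B k i j * z.1 i) * fderiv ℝ f z (0, Pi.single k 1)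

/-- The squared length of the sub-gradient: `|∇_G f|² = Σ_j (X_j f)²`. -/
noncomputable def gradSq {n₁ n : ℕ} (B : Fin n → Matrix (Fin n₁) (Fin n₁) ℝ)
    (f : (Fin n₁ → ℝ) × (Fin n → ℝ) → ℝ) (z : (Fin n₁ → ℝ) × (Fin n → ℝ)) : ℝ :=
  ∑ j : Fin n₁, (Xvf B j f z) ^ 2

/-- The length `|∇_G f|` of the sub-gradient. -/
noncomputable def gradLen {n₁ n : ℕ} (B : Fin n → Matrix (Fin n₁) (Fin n₁) ℝ)
    (f : (Fin n₁ → ℝ) × (Fin n → ℝ) → ℝ) (z : (Fin n₁ → ℝ) × (Fin n → ℝ)) : ℝ :=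
  Real.sqrt (gradSq B f z)

/-- The sub-Laplacian `Δ_G f = Σ_j X_j (X_j f)`. -/
noncomputable def subLap {n₁ n : ℕ} (B : Fin n → Matrix (Fin n₁) (Fin n₁) ℝ)
    (f : (Fin n₁ → ℝ) × (Fin n → ℝ) → ℝ) (z : (Fin n₁ → ℝ) × (Fin n → ℝ)) : ℝ :=
  ∑ j : Fin n₁, Xvf B j (Xvf B j f) z

/-- The dilations `δ_λ(x,t) = (λ x, λ² t)` of the step-2 group. -/
def dil2 {n₁ n : ℕ} (l : ℝ) (z : (Fin n₁ → ℝ) × (Fin n → ℝ)) :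
    (Fin n₁ → ℝ) × (Fin n → ℝ) :=
  (fun i => l * z.1 i, fun k => l ^ 2 * z.2 k)

/-- A homogeneous quasi-norm on the step-2 group: continuous, nonnegative, vanishing
exactly at the origin, and `N(δ_λ(z)) = λ N(z)` for all `λ > 0`. -/
def IsHomQuasiNorm2 {n₁ n : ℕ} (N : (Fin n₁ → ℝ) × (Fin n → ℝ) → ℝ) : Prop :=
  Continuous N ∧ (∀ z, 0 ≤ N z) ∧ (∀ z, N z = 0 ↔ z = 0) ∧
    ∀ l : ℝ, 0 < l → ∀ z, N (dil2 l z) = l * N z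

/-- The probability measure `μ_p = Z⁻¹ e^{−a N(z)^p} dz` on the step-2 group. -/
noncomputable def muP {n₁ n : ℕ} (N : (Fin n₁ → ℝ) × (Fin n → ℝ) → ℝ) (a p : ℝ) :
    Measure ((Fin n₁ → ℝ) × (Fin n → ℝ)) :=
  ((∫⁻ z, ENNReal.ofReal (Real.exp (-(a * N z ^ p))))⁻¹) •
    (volume.withDensity fun z => ENNReal.ofReal (Real.exp (-(a * N z ^ p))))

/-- The direction of the vector field `X_j` at `z`. -/
noncomputable def vdir {n₁ n : ℕ} (B : Fin n → Matrix (Fin n₁) (Fin n₁) ℝ) (j : Fin n₁)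
    (z : (Fin n₁ → ℝ) × (Fin n → ℝ)) : (Fin n₁ → ℝ) × (Fin n → ℝ) :=
  (Pi.single j 1, fun k => (1 / 2) * ∑ i : Fin n₁, B k i j * z.1 i)

lemma Xvf_eq {n₁ n : ℕ} (B : Fin n → Matrix (Fin n₁) (Fin n₁) ℝ) (j : Fin n₁)
    (f : (Fin n₁ → ℝ) × (Fin n → ℝ) → ℝ) (z : (Fin n₁ → ℝ) × (Fin n → ℝ)) :
    Xvf B j f z = fderiv ℝ f z (vdir B j z) := by
  have h : vdir B j z = ((Pi.single j 1, 0) : (Fin n₁ → ℝ) × (Fin n → ℝ)) +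
      ∑ k : Fin n, ((1 / 2) * ∑ i : Fin n₁, B k i j * z.1 i) •
        ((0, Pi.single k 1) : (Fin n₁ → ℝ) × (Fin n → ℝ)) := by
    ext k
    · simp [vdir, Prod.fst_sum]
    · simp [vdir, Prod.snd_sum, Finset.sum_apply, Pi.single_apply]
  rw [h, map_add, map_sum, Xvf, Finset.mul_sum]
  congr 1
  refine Finset.sum_congr rfl fun k _ => ?_
  rw [map_smul, smul_eq_mul]; ring

lemma contDiff_vdir {n₁ n : ℕ} (B : Fin n → Matrix (Fin n₁) (Fin n₁) ℝ) (j : Fin n₁)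
    (m : WithTop ℕ∞) : ContDiff ℝ m (vdir B j) := by
  unfold vdir
  fun_prop

lemma Xvf_contDiffAt {n₁ n : ℕ} (B : Fin n → Matrix (Fin n₁) (Fin n₁) ℝ) (j : Fin n₁)
    {f : (Fin n₁ → ℝ) × (Fin n → ℝ) → ℝ} {z : (Fin n₁ → ℝ) × (Fin n → ℝ)} {m m' : WithTop ℕ∞}
    (hf : ContDiffAt ℝ m f z) (h : m' + 1 ≤ m) : ContDiffAt ℝ m' (Xvf B j f) z := by
  have : Xvf B j f = fun z => fderiv ℝ f z (vdir B j z) := funext fun z => Xvf_eq B j f z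
  rw [this]
  exact (hf.fderiv_right h).clm_apply (contDiff_vdir B j m').contDiffAt

lemma Xvf_continuous {n₁ n : ℕ} (B : Fin n → Matrix (Fin n₁) (Fin n₁) ℝ) (j : Fin n₁)
    {f : (Fin n₁ → ℝ) × (Fin n → ℝ) → ℝ} (hf : ContDiff ℝ 1 f) : Continuous (Xvf B j f) :=
  continuous_iff_continuousAt.2 fun z =>
    (Xvf_contDiffAt B j (m' := 0) hf.contDiffAt (by norm_num)).continuousAt

lemma dil2_vdir {n₁ n : ℕ} (B : Fin n → Matrix (Fin n₁) (Fin n₁) ℝ) (j : Fin n₁) (l : ℝ)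
    (z : (Fin n₁ → ℝ) × (Fin n → ℝ)) : dil2 l (vdir B j z) = l • vdir B j (dil2 l z) := by
  ext k
  · simp [dil2, vdir]
  · simp only [dil2, vdir, Prod.smul_snd, Pi.smul_apply, smul_eq_mul, Finset.mul_sum]
    refine Finset.sum_congr rfl fun i _ => ?_
    ring

/-- The dilation as a continuous linear map. -/
noncomputable def dilL (n₁ n : ℕ) (l : ℝ) :
    ((Fin n₁ → ℝ) × (Fin n → ℝ)) →L[ℝ] ((Fin n₁ → ℝ) × (Fin n → ℝ)) :=
  (l • ContinuousLinearMap.fst ℝ _ _).prod (l ^ 2 • ContinuousLinearMap.snd ℝ _ _)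

lemma dilL_apply {n₁ n : ℕ} (l : ℝ) (z : (Fin n₁ → ℝ) × (Fin n → ℝ)) :
    dilL n₁ n l z = dil2 l z := by
  ext k <;> simp [dilL, dil2]

lemma dil2_ne {n₁ n : ℕ} {l : ℝ} (hl : 0 < l) {z : (Fin n₁ → ℝ) × (Fin n → ℝ)} (hz : z ≠ 0) :
    dil2 l z ≠ 0 := by
  contrapose! hz
  ext k
  · have := congrFun (congrArg Prod.fst hz) k
    simp [dil2] at this
    simpa [hl.ne'] using this
  · have := congrFun (congrArg Prod.snd hz) k
    simp [dil2] at this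
    simpa [hl.ne'] using this

lemma Xvf_hom {n₁ n : ℕ} (B : Fin n → Matrix (Fin n₁) (Fin n₁) ℝ) (j : Fin n₁)
    {F : (Fin n₁ → ℝ) × (Fin n → ℝ) → ℝ} (hF : ∀ l : ℝ, 0 < l → ∀ z, F (dil2 l z) = l * F z)
    (hd : ∀ z, z ≠ 0 → DifferentiableAt ℝ F z) (l : ℝ) (hl : 0 < l)
    (z : (Fin n₁ → ℝ) × (Fin n → ℝ)) (hz : z ≠ 0) : Xvf B j F (dil2 l z) = Xvf B j F z := by
  have h1 : HasFDerivAt (fun z => F (dilL n₁ n l z))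
      ((fderiv ℝ F (dilL n₁ n l z)).comp (dilL n₁ n l)) z := by
    refine HasFDerivAt.comp z ?_ (dilL n₁ n l).hasFDerivAt
    rw [dilL_apply]
    exact (hd _ (dil2_ne hl hz)).hasFDerivAt
  have h2 : HasFDerivAt (fun z => F (dilL n₁ n l z)) (l • fderiv ℝ F z) z := by
    have : (fun z => F (dilL n₁ n l z)) = fun z => l * F z := by
      funext z; rw [dilL_apply, hF l hl]
    rw [this]
    exact (hd z hz).hasFDerivAt.const_mul l
  have h3 := congrArg (fun L => L (vdir B j z)) (h1.unique h2)
  simp only [ContinuousLinearMap.comp_apply, dilL_apply, dil2_vdir, map_smul, smul_eq_mul,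
    _root_.smul_apply] at h3
  rw [Xvf_eq, Xvf_eq]
  exact mul_left_cancel₀ hl.ne' h3

lemma exists_dil {n₁ n : ℕ} {z : (Fin n₁ → ℝ) × (Fin n → ℝ)} (hz : z ≠ 0) :
    ∃ l : ℝ, 0 < l ∧ ‖dil2 l z‖ = 1 := by
  have hcont : Continuous fun l : ℝ => ‖dil2 l z‖ := by
    unfold dil2; fun_prop
  have hzn : 0 < ‖z‖ := norm_pos_iff.2 hz
  set L := 1 + 1 / ‖z‖ with hL
  have hL1 : 1 ≤ L := by have : 0 ≤ 1 / ‖z‖ := by positivity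
                         linarith
  have hbig : 1 ≤ ‖dil2 L z‖ := by
    have e : dil2 L z = (L • z.1, L ^ 2 • z.2) := by ext k <;> simp [dil2]
    have h1 : L * ‖z‖ ≤ ‖dil2 L z‖ := by
      rw [e, Prod.norm_def, Prod.norm_def, mul_max_of_nonneg _ _ (by linarith)]
      simp only [norm_smul, norm_pow, Real.norm_eq_abs, abs_of_nonneg (by linarith : (0:ℝ) ≤ L)]
      gcongr
      nlinarith
    have h2 : L * ‖z‖ = ‖z‖ + 1 := by rw [hL]; field_simp
    linarith
  have h0 : ‖dil2 0 z‖ = 0 := by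
    rw [norm_eq_zero]; ext k <;> simp [dil2]
  obtain ⟨l, hl, hl1⟩ := intermediate_value_Icc (by linarith : (0:ℝ) ≤ L) hcont.continuousOn
    (show (1:ℝ) ∈ Set.Icc _ _ from ⟨by rw [h0]; norm_num, hbig⟩)
  refine ⟨l, lt_of_le_of_ne hl.1 ?_, hl1⟩
  rintro rfl
  simp only [h0] at hl1
  norm_num at hl1

lemma bdd_hom {n₁ n : ℕ} {F : (Fin n₁ → ℝ) × (Fin n → ℝ) → ℝ}
    (hF : ∀ l : ℝ, 0 < l → ∀ z, z ≠ 0 → F (dil2 l z) = F z)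
    (hc : ∀ z, z ≠ 0 → ContinuousAt F z) : ∃ C : ℝ, 0 < C ∧ ∀ z, z ≠ 0 → |F z| ≤ C := by
  obtain ⟨C, hC⟩ := (isCompact_sphere (0 : (Fin n₁ → ℝ) × (Fin n → ℝ)) 1).exists_bound_of_continuousOn
    (f := F) (fun z hz => (hc z (by rintro rfl; simp at hz)).continuousWithinAt)
  refine ⟨max C 1, by positivity, fun z hz => ?_⟩
  obtain ⟨l, hl, h1⟩ := exists_dil hz
  rw [← hF l hl z hz]
  exact (hC _ (by simpa using h1)).trans (le_max_left _ _)

lemma vol_haar (n₁ n : ℕ) :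
    (volume : Measure ((Fin n₁ → ℝ) × (Fin n → ℝ))).IsAddHaarMeasure := by
  apply Measure.prod.instIsAddHaarMeasure

lemma Xvf_zero_of_notMem {n₁ n : ℕ} (B : Fin n → Matrix (Fin n₁) (Fin n₁) ℝ) (j : Fin n₁)
    {f : (Fin n₁ → ℝ) × (Fin n → ℝ) → ℝ} {z : (Fin n₁ → ℝ) × (Fin n → ℝ)}
    (h : z ∉ tsupport f) : Xvf B j f z = 0 := by
  rw [Xvf_eq, fderiv_of_notMem_tsupport ℝ h]; simp

lemma Xvf_integral {n₁ n : ℕ} (B : Fin n → Matrix (Fin n₁) (Fin n₁) ℝ) (j : Fin n₁)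
    {H : (Fin n₁ → ℝ) × (Fin n → ℝ) → ℝ} (hH : ContDiff ℝ 1 H) (hs : HasCompactSupport H) :
    Integrable (Xvf B j H) ∧ ∫ z, Xvf B j H z = 0 := by
  have := vol_haar n₁ n
  have hmain : ∀ (φ : (Fin n₁ → ℝ) × (Fin n → ℝ) → ℝ) (v : (Fin n₁ → ℝ) × (Fin n → ℝ)),
      ContDiff ℝ 1 φ → (∀ z, fderiv ℝ φ z v = 0) →
      Integrable (fun z => φ z * fderiv ℝ H z v) ∧ ∫ z, φ z * fderiv ℝ H z v = 0 := by
    intro φ v hφ hφ0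
    have hi : Integrable (fun z => φ z * fderiv ℝ H z v) := by
      refine Continuous.integrable_of_hasCompactSupport ?_ ?_
      · exact hφ.continuous.mul ((hH.continuous_fderiv (by norm_num)).clm_apply continuous_const)
      · refine hs.mono' fun z hz => ?_
        by_contra h
        exact hz (by simp [fderiv_of_notMem_tsupport ℝ h])
    refine ⟨hi, ?_⟩
    rw [integral_mul_fderiv_eq_neg_fderiv_mul_of_integrable]
    · simp [hφ0]
    · simp [hφ0]
    · exact hi
    · exact Continuous.integrable_of_hasCompactSupport (hφ.continuous.mul hH.continuous) hs.mul_left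
    · intro z _; exact hφ.differentiable (by norm_num) z
    · intro z _; exact hH.differentiable (by norm_num) z
  have h1 := hmain (fun _ => 1) (Pi.single j 1, 0) contDiff_const (by simp)
  have h2 : ∀ k : Fin n, _ := fun k => hmain (fun z => ∑ i : Fin n₁, B k i j * z.1 i)
    (0, Pi.single k 1) (by fun_prop) (by
      intro z
      have : HasFDerivAt (fun z : (Fin n₁ → ℝ) × (Fin n → ℝ) => ∑ i : Fin n₁, B k i j * z.1 i)
          (∑ i : Fin n₁, B k i j • (ContinuousLinearMap.proj (R := ℝ) (φ := fun _ : Fin n₁ => ℝ) i).comp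
            (ContinuousLinearMap.fst ℝ (Fin n₁ → ℝ) (Fin n → ℝ))) z := by
        refine HasFDerivAt.fun_sum fun i _ => HasFDerivAt.const_mul ?_ _
        exact ((ContinuousLinearMap.proj (R := ℝ) (φ := fun _ : Fin n₁ => ℝ) i).comp
            (ContinuousLinearMap.fst ℝ (Fin n₁ → ℝ) (Fin n → ℝ))).hasFDerivAt
      rw [this.fderiv]
      simp)
  simp only [one_mul] at h1
  have hs2 := integrable_finsetSum Finset.univ fun k (_ : k ∈ Finset.univ) => (h2 k).1
  have e : Xvf B j H = fun z => fderiv ℝ H z (Pi.single j 1, 0) + (1 / 2) *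
      ∑ k : Fin n, (∑ i : Fin n₁, B k i j * z.1 i) * fderiv ℝ H z (0, Pi.single k 1) := rfl
  rw [e]
  refine ⟨h1.1.add (hs2.const_mul _), ?_⟩
  rw [integral_add h1.1 (hs2.const_mul _), h1.2, integral_const_mul,
    integral_finsetSum _ fun k _ => (h2 k).1]
  simp [fun k => (h2 k).2]

lemma integral_muP {n₁ n : ℕ} (N : (Fin n₁ → ℝ) × (Fin n → ℝ) → ℝ) (hN : Continuous N) (a p : ℝ)
    (hp : 0 ≤ p) (g : (Fin n₁ → ℝ) × (Fin n → ℝ) → ℝ) :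
    ∫ z, g z ∂(muP N a p) = ((∫⁻ z, ENNReal.ofReal (Real.exp (-(a * N z ^ p))))⁻¹).toReal *
      ∫ z, g z * Real.exp (-(a * N z ^ p)) := by
  have hc : Continuous fun z => Real.exp (-(a * N z ^ p)) :=
    (continuous_const.mul (hN.rpow_const fun _ => Or.inr hp)).neg.rexp
  rw [muP, integral_smul_measure, integral_withDensity_eq_integral_toReal_smul]
  · rw [smul_eq_mul]
    congr 1
    refine integral_congr_ae (Filter.Eventually.of_forall fun z => ?_)
    simp only [smul_eq_mul]
    rw [ENNReal.toReal_ofReal (Real.exp_pos _).le, mul_comm]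
  · exact hc.measurable.ennreal_ofReal
  · exact Filter.Eventually.of_forall fun z => ENNReal.ofReal_lt_top

lemma young_pt {F G u p q δ : ℝ} (hF : 0 ≤ F) (hG : 0 ≤ G) (hu : 0 ≤ u) (hδ : 0 < δ)
    (hqp : q.HolderConjugate p) :
    q * F ^ (q - 1) * (G * u) ≤ (δ ^ q)⁻¹ * G ^ q + (q / p * δ ^ p) * (F ^ q * u ^ p) := by
  have hq := hqp.pos
  have hp := hqp.symm.pos
  have hF1 : 0 ≤ F ^ (q - 1) := Real.rpow_nonneg hF _
  have h := Real.young_inequality_of_nonneg (a := G / δ) (b := δ * F ^ (q - 1) * u)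
    (by positivity) (by positivity) hqp
  have e1 : (G / δ) ^ q = (δ ^ q)⁻¹ * G ^ q := by
    rw [Real.div_rpow hG hδ.le]; ring
  have e2 : (δ * F ^ (q - 1) * u) ^ p = δ ^ p * (F ^ q * u ^ p) := by
    rw [Real.mul_rpow (by positivity) hu, Real.mul_rpow hδ.le hF1, ← Real.rpow_mul hF,
      hqp.sub_one_mul_conj]
    ring
  rw [e1, e2] at h
  have e3 : G / δ * (δ * F ^ (q - 1) * u) = F ^ (q - 1) * (G * u) := by field_simp
  rw [e3] at h
  calc q * F ^ (q - 1) * (G * u) = q * (F ^ (q - 1) * (G * u)) := by ring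
    _ ≤ q * ((δ ^ q)⁻¹ * G ^ q / q + δ ^ p * (F ^ q * u ^ p) / p) := by gcongr
    _ = _ := by field_simp

lemma upow_bound {s g N p C K : ℝ} (hs : 0 ≤ s) (hg : 0 ≤ g) (hN : 0 ≤ N) (hC : 0 ≤ C)
    (hsN : s ≤ C * N) (hgK : g ≤ K) (hp : 2 < p) :
    (s * g) ^ p ≤ (C ^ (p - 1) * K ^ (p - 2)) * (N ^ (p - 1) * (s * g ^ 2)) := by
  have e1 : s ^ p = s ^ (p - 1) * s := by
    have := Real.rpow_add_of_nonneg hs (by linarith : 0 ≤ p - 1) zero_le_one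
    rwa [sub_add_cancel, Real.rpow_one] at this
  have e2 : g ^ p = g ^ (p - 2) * g ^ 2 := by
    have := Real.rpow_add_of_nonneg hg (by linarith : 0 ≤ p - 2) zero_le_two
    rw [sub_add_cancel] at this
    rw [this]; norm_num
  have h1 : s ^ (p - 1) ≤ C ^ (p - 1) * N ^ (p - 1) := by
    rw [← Real.mul_rpow hC hN]
    exact Real.rpow_le_rpow hs hsN (by linarith)
  have h2 : g ^ (p - 2) ≤ K ^ (p - 2) := Real.rpow_le_rpow hg hgK (by linarith)
  rw [Real.mul_rpow hs hg, e1, e2]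
  calc s ^ (p - 1) * s * (g ^ (p - 2) * g ^ 2)
      = (s ^ (p - 1) * g ^ (p - 2)) * (s * g ^ 2) := by ring
    _ ≤ ((C ^ (p - 1) * N ^ (p - 1)) * K ^ (p - 2)) * (s * g ^ 2) := by
        gcongr
    _ = _ := by ring

/-- The cut-off vector field `U_j = χ(N) x_{j₀}² N⁻¹ X_j N`. -/
noncomputable def sFun {n₁ n : ℕ} (N : (Fin n₁ → ℝ) × (Fin n → ℝ) → ℝ) (j₀ : Fin n₁)
    (z : (Fin n₁ → ℝ) × (Fin n → ℝ)) : ℝ :=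
  Real.smoothTransition (N z - 1) * (z.1 j₀ ^ 2 * (N z)⁻¹)

noncomputable def hFun {n₁ n : ℕ} (B : Fin n → Matrix (Fin n₁) (Fin n₁) ℝ)
    (N : (Fin n₁ → ℝ) × (Fin n → ℝ) → ℝ) (j₀ j : Fin n₁)
    (z : (Fin n₁ → ℝ) × (Fin n → ℝ)) : ℝ :=
  z.1 j₀ ^ 2 * (N z)⁻¹ * Xvf B j N z

noncomputable def UFun {n₁ n : ℕ} (B : Fin n → Matrix (Fin n₁) (Fin n₁) ℝ)
    (N : (Fin n₁ → ℝ) × (Fin n → ℝ) → ℝ) (j₀ j : Fin n₁)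
    (z : (Fin n₁ → ℝ) × (Fin n → ℝ)) : ℝ :=
  sFun N j₀ z * Xvf B j N z

section
variable {n₁ n : ℕ} {B : Fin n → Matrix (Fin n₁) (Fin n₁) ℝ}
  {N : (Fin n₁ → ℝ) × (Fin n → ℝ) → ℝ}

lemma N_cd (hsm : ContDiffOn ℝ (⊤ : ℕ∞) N {(0 : (Fin n₁ → ℝ) × (Fin n → ℝ))}ᶜ)
    {z : (Fin n₁ → ℝ) × (Fin n → ℝ)} (hz : z ≠ 0) : ContDiffAt ℝ (⊤ : ℕ∞) N z :=
  hsm.contDiffAt (isOpen_compl_singleton.mem_nhds hz)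

lemma N_pos (hN : IsHomQuasiNorm2 N) {z : (Fin n₁ → ℝ) × (Fin n → ℝ)} (hz : z ≠ 0) : 0 < N z :=
  lt_of_le_of_ne (hN.2.1 z) fun h => hz ((hN.2.2.1 z).1 h.symm)

lemma hFun_cd (hN : IsHomQuasiNorm2 N)
    (hsm : ContDiffOn ℝ (⊤ : ℕ∞) N {(0 : (Fin n₁ → ℝ) × (Fin n → ℝ))}ᶜ) (j₀ j : Fin n₁)
    {z : (Fin n₁ → ℝ) × (Fin n → ℝ)} (hz : z ≠ 0) :
    ContDiffAt ℝ 1 (hFun B N j₀ j) z := by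
  have h1 : ContDiffAt ℝ 1 N z := (N_cd hsm hz).of_le (by exact_mod_cast le_top)
  have h2 : ContDiffAt ℝ 1 (Xvf B j N) z :=
    Xvf_contDiffAt B j (N_cd hsm hz)
      (show (((2 : ℕ∞) : WithTop ℕ∞)) ≤ _ from WithTop.coe_le_coe.2 le_top)
  have h3 : ContDiffAt ℝ 1 (fun z : (Fin n₁ → ℝ) × (Fin n → ℝ) => z.1 j₀ ^ 2) z := by fun_prop
  exact (h3.mul (h1.inv (N_pos hN hz).ne')).mul h2

lemma UFun_eq (j₀ j : Fin n₁) (z : (Fin n₁ → ℝ) × (Fin n → ℝ)) :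
    UFun B N j₀ j z = Real.smoothTransition (N z - 1) * hFun B N j₀ j z := by
  unfold UFun sFun hFun; ring

lemma UFun_cd_ne (hN : IsHomQuasiNorm2 N)
    (hsm : ContDiffOn ℝ (⊤ : ℕ∞) N {(0 : (Fin n₁ → ℝ) × (Fin n → ℝ))}ᶜ) (j₀ j : Fin n₁)
    {z : (Fin n₁ → ℝ) × (Fin n → ℝ)} (hz : z ≠ 0) :
    ContDiffAt ℝ 1 (UFun B N j₀ j) z := by
  have : UFun B N j₀ j = fun z => Real.smoothTransition (N z - 1) * hFun B N j₀ j z :=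
    funext fun z => UFun_eq j₀ j z
  rw [this]
  have h1 : ContDiffAt ℝ 1 N z := (N_cd hsm hz).of_le (by exact_mod_cast le_top)
  have h2 : ContDiff ℝ 1 Real.smoothTransition := Real.smoothTransition.contDiff (n := 1)
  exact (h2.contDiffAt.comp z (h1.sub contDiffAt_const)).mul (hFun_cd hN hsm j₀ j hz)

lemma s_zero (hN : IsHomQuasiNorm2 N) (j₀ : Fin n₁) :
    ∀ᶠ z in nhds (0 : (Fin n₁ → ℝ) × (Fin n → ℝ)), sFun N j₀ z = 0 := by
  have h0 : N 0 = 0 := (hN.2.2.1 0).2 rfl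
  have : ∀ᶠ z in nhds (0 : (Fin n₁ → ℝ) × (Fin n → ℝ)), N z < 1 :=
    hN.1.continuousAt.eventually_lt_const (by rw [h0]; norm_num)
  filter_upwards [this] with z hz
  rw [sFun, Real.smoothTransition.zero_of_nonpos (by linarith), zero_mul]

lemma UFun_cd (hN : IsHomQuasiNorm2 N)
    (hsm : ContDiffOn ℝ (⊤ : ℕ∞) N {(0 : (Fin n₁ → ℝ) × (Fin n → ℝ))}ᶜ) (j₀ j : Fin n₁) :
    ContDiff ℝ 1 (UFun B N j₀ j) := by
  rw [contDiff_iff_contDiffAt]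
  intro z
  by_cases hz : z = 0
  · subst hz
    refine (contDiffAt_const (c := (0:ℝ))).congr_of_eventuallyEq ?_
    filter_upwards [s_zero hN j₀] with z hz
    rw [UFun, hz, zero_mul]
  · exact UFun_cd_ne hN hsm j₀ j hz

lemma Xvf_congr (j : Fin n₁) {f g : (Fin n₁ → ℝ) × (Fin n → ℝ) → ℝ}
    {z : (Fin n₁ → ℝ) × (Fin n → ℝ)} (h : f =ᶠ[nhds z] g) : Xvf B j f z = Xvf B j g z := by
  rw [Xvf_eq, Xvf_eq, h.fderiv_eq]

lemma XN_bdd (hN : IsHomQuasiNorm2 N)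
    (hsm : ContDiffOn ℝ (⊤ : ℕ∞) N {(0 : (Fin n₁ → ℝ) × (Fin n → ℝ))}ᶜ) :
    ∃ K : ℝ, 0 < K ∧ ∀ z, z ≠ 0 → gradLen B N z ≤ K := by
  obtain ⟨K, hK, h⟩ := bdd_hom (F := gradLen B N) (by
      intro l hl z hz
      unfold gradLen gradSq
      congr 1
      refine Finset.sum_congr rfl fun j _ => ?_
      rw [Xvf_hom B j hN.2.2.2 (fun z hz => (N_cd hsm hz).differentiableAt (by simp)) l hl z hz])
    (by
      intro z hz
      unfold gradLen gradSq
      have : ∀ j, ContinuousAt (Xvf B j N) z := fun j =>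
        (Xvf_contDiffAt B j (m' := 0) (N_cd hsm hz) (by exact_mod_cast le_top)).continuousAt
      fun_prop)
  exact ⟨K, hK, fun z hz => (le_abs_self _).trans (h z hz)⟩

lemma coord_bdd (hN : IsHomQuasiNorm2 N) :
    ∃ C : ℝ, 0 < C ∧ ∀ z : (Fin n₁ → ℝ) × (Fin n → ℝ), ‖z.1‖ ≤ C * N z ∧ ‖z.2‖ ≤ C * N z ^ 2 := by
  have hc := hN.1
  have hdil : ∀ (l : ℝ) (z : (Fin n₁ → ℝ) × (Fin n → ℝ)), dil2 l z = (l • z.1, l ^ 2 • z.2) := by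
    intro l z; ext k <;> simp [dil2]
  obtain ⟨C1, hC1, h1⟩ := bdd_hom (F := fun z : (Fin n₁ → ℝ) × (Fin n → ℝ) => ‖z.1‖ / N z) (by
      intro l hl z hz
      have := N_pos hN hz
      simp only [hN.2.2.2 l hl]
      rw [hdil]
      simp only [norm_smul, Real.norm_eq_abs, abs_of_pos hl]
      field_simp)
    (by
      intro z hz
      exact ContinuousAt.div (by fun_prop) hc.continuousAt (N_pos hN hz).ne')
  obtain ⟨C2, hC2, h2⟩ := bdd_hom (F := fun z : (Fin n₁ → ℝ) × (Fin n → ℝ) => ‖z.2‖ / N z ^ 2) (by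
      intro l hl z hz
      have := N_pos hN hz
      simp only [hN.2.2.2 l hl]
      rw [hdil]
      simp only [norm_smul, norm_pow, Real.norm_eq_abs, abs_of_pos hl]
      field_simp)
    (by
      intro z hz
      exact ContinuousAt.div (by fun_prop) (by fun_prop) (pow_pos (N_pos hN hz) 2).ne')
  refine ⟨max C1 C2, by positivity, fun z => ?_⟩
  by_cases hz : z = 0
  · subst hz
    have := hN.2.1 0
    constructor
    · simp; positivity
    · simp; positivity
  · have hp := N_pos hN hz
    have a1 := (le_abs_self _).trans (h1 z hz)
    have a2 := (le_abs_self _).trans (h2 z hz)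
    rw [div_le_iff₀ (by positivity)] at a1 a2
    exact ⟨a1.trans (by gcongr; exact le_max_left _ _), a2.trans (by gcongr; exact le_max_right _ _)⟩

lemma XU_bdd (hN : IsHomQuasiNorm2 N)
    (hsm : ContDiffOn ℝ (⊤ : ℕ∞) N {(0 : (Fin n₁ → ℝ) × (Fin n → ℝ))}ᶜ) (j₀ j : Fin n₁) :
    ∃ K : ℝ, 0 < K ∧ ∀ z, |Xvf B j (UFun B N j₀ j) z| ≤ K := by
  obtain ⟨C, hC, hCz⟩ := coord_bdd hN
  obtain ⟨K1, hK1, h1⟩ := bdd_hom (F := Xvf B j (hFun B N j₀ j))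
    (Xvf_hom B j (by
      intro l hl z
      by_cases hz : z = 0
      · subst hz
        have : dil2 l (0 : (Fin n₁ → ℝ) × (Fin n → ℝ)) = 0 := by ext k <;> simp [dil2]
        rw [this]; simp [hFun]
      · unfold hFun
        rw [Xvf_hom B j hN.2.2.2 (fun z hz => (N_cd hsm hz).differentiableAt (by simp)) l hl z hz,
          hN.2.2.2 l hl]
        have := N_pos hN hz
        simp only [dil2]
        field_simp)
      (fun z hz => (hFun_cd hN hsm j₀ j hz).differentiableAt (by norm_num)))
    (fun z hz => (Xvf_contDiffAt B j (m' := 0) (hFun_cd hN hsm j₀ j hz) (by norm_num)).continuousAt)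
  obtain ⟨K2, hK2⟩ := (isCompact_closedBall (0 : (Fin n₁ → ℝ) × (Fin n → ℝ))
    (C * 4)).exists_bound_of_continuousOn
    (Xvf_continuous B j (UFun_cd (B := B) hN hsm j₀ j)).continuousOn
  refine ⟨max K1 K2, by positivity, fun z => ?_⟩
  by_cases hz : N z ≤ 2
  · refine (hK2 z ?_).trans (le_max_right _ _)
    have h0 := hN.2.1 z
    rw [mem_closedBall_zero_iff, Prod.norm_def]
    refine max_le ((hCz z).1.trans ?_) ((hCz z).2.trans ?_)
    · gcongr; linarith
    · gcongr; nlinarith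
  · push Not at hz
    have hz0 : z ≠ 0 := by
      rintro rfl
      rw [(hN.2.2.1 0).2 rfl] at hz; norm_num at hz
    rw [Xvf_congr (g := hFun B N j₀ j)]
    · exact (h1 z hz0).trans (le_max_left _ _)
    · filter_upwards [hN.1.continuousAt.eventually_const_lt hz] with y hy
      rw [UFun_eq, Real.smoothTransition.one_of_one_le (by linarith), one_mul]

/-- The function whose `X_j` derivative is integrated. -/
noncomputable def HFun {n₁ n : ℕ} (B : Fin n → Matrix (Fin n₁) (Fin n₁) ℝ)
    (N : (Fin n₁ → ℝ) × (Fin n → ℝ) → ℝ) (j₀ : Fin n₁) (a p q : ℝ)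
    (f : (Fin n₁ → ℝ) × (Fin n → ℝ) → ℝ) (j : Fin n₁)
    (z : (Fin n₁ → ℝ) × (Fin n → ℝ)) : ℝ :=
  |f z| ^ q * UFun B N j₀ j z * Real.exp (-(a * N z ^ p))

lemma HFun_cd (hN : IsHomQuasiNorm2 N)
    (hsm : ContDiffOn ℝ (⊤ : ℕ∞) N {(0 : (Fin n₁ → ℝ) × (Fin n → ℝ))}ᶜ) (j₀ j : Fin n₁)
    (a p q : ℝ) (hq : 1 < q) {f : (Fin n₁ → ℝ) × (Fin n → ℝ) → ℝ} (hf : ContDiff ℝ 1 f) :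
    ContDiff ℝ 1 (HFun B N j₀ a p q f j) := by
  rw [contDiff_iff_contDiffAt]
  intro z
  by_cases hz : z = 0
  · subst hz
    refine (contDiffAt_const (c := (0:ℝ))).congr_of_eventuallyEq ?_
    filter_upwards [s_zero hN j₀] with z hz
    rw [HFun, UFun, hz, zero_mul, mul_zero, zero_mul]
  · have h1 : ContDiffAt ℝ 1 N z := (N_cd hsm hz).of_le (by exact_mod_cast le_top)
    have h2 : ContDiff ℝ 1 fun z => |f z| ^ q := (contDiff_norm_rpow (E := ℝ) hq).comp hf
    exact (h2.contDiffAt.mul (UFun_cd hN hsm j₀ j).contDiffAt).mul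
      ((contDiffAt_const.mul (h1.rpow_const_of_ne (N_pos hN hz).ne')).neg.exp)

lemma XH_eq (hN : IsHomQuasiNorm2 N)
    (hsm : ContDiffOn ℝ (⊤ : ℕ∞) N {(0 : (Fin n₁ → ℝ) × (Fin n → ℝ))}ᶜ) (j₀ j : Fin n₁)
    (a p q : ℝ) (hq : 1 < q) {f : (Fin n₁ → ℝ) × (Fin n → ℝ) → ℝ} (hf : ContDiff ℝ 1 f)
    (z : (Fin n₁ → ℝ) × (Fin n → ℝ)) :
    Xvf B j (HFun B N j₀ a p q f j) z =
      (q * |f z| ^ (q - 2) * f z * (sFun N j₀ z * (Xvf B j f z * Xvf B j N z)) +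
        |f z| ^ q * Xvf B j (UFun B N j₀ j) z -
        a * p * N z ^ (p - 1) * |f z| ^ q * (sFun N j₀ z * Xvf B j N z ^ 2)) *
      Real.exp (-(a * N z ^ p)) := by
  by_cases hz : z = 0
  · subst hz
    have e0 := (s_zero hN j₀).self_of_nhds
    have e1 : HFun B N j₀ a p q f j =ᶠ[nhds 0] fun _ => 0 := by
      filter_upwards [s_zero hN j₀] with z hz
      rw [HFun, UFun, hz, zero_mul, mul_zero, zero_mul]
    have e2 : UFun B N j₀ j =ᶠ[nhds 0] fun _ => 0 := by
      filter_upwards [s_zero hN j₀] with z hz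
      rw [UFun, hz, zero_mul]
    rw [Xvf_congr j e1, Xvf_congr j e2, e0]
    simp [Xvf]
  · have hNd : HasFDerivAt N (fderiv ℝ N z) z :=
      ((N_cd hsm hz).differentiableAt (by simp)).hasFDerivAt
    have hfd : HasFDerivAt f (fderiv ℝ f z) z := (hf.differentiable (by norm_num) z).hasFDerivAt
    have hUd : HasFDerivAt (UFun B N j₀ j) (fderiv ℝ (UFun B N j₀ j) z) z :=
      ((UFun_cd hN hsm j₀ j).differentiable (by norm_num) z).hasFDerivAt
    have hg := (hasDerivAt_abs_rpow (f z) hq).comp_hasFDerivAt z hfd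
    have hw := ((hNd.rpow_const (p := p) (Or.inl (N_pos hN hz).ne')).const_mul a).neg.exp
    have hH := (hg.mul hUd).mul hw
    have : HasFDerivAt (HFun B N j₀ a p q f j) _ z := hH
    rw [Xvf_eq, this.fderiv, Xvf_eq, Xvf_eq, Xvf_eq]
    simp only [_root_.add_apply, _root_.smul_apply, _root_.neg_apply,
      smul_eq_mul, Function.comp, Pi.mul_apply, Pi.neg_apply, UFun, Xvf_eq]
    ring

lemma grad_supp {f : (Fin n₁ → ℝ) × (Fin n → ℝ) → ℝ} {z : (Fin n₁ → ℝ) × (Fin n → ℝ)}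
    (h : z ∉ tsupport f) : gradLen B f z = 0 := by
  simp [gradLen, gradSq, Xvf_zero_of_notMem B _ h]

lemma gradLen_nonneg (f : (Fin n₁ → ℝ) × (Fin n → ℝ) → ℝ) (z : (Fin n₁ → ℝ) × (Fin n → ℝ)) :
    0 ≤ gradLen B f z := Real.sqrt_nonneg _

lemma gradLen_sq (f : (Fin n₁ → ℝ) × (Fin n → ℝ) → ℝ) (z : (Fin n₁ → ℝ) × (Fin n → ℝ)) :
    gradLen B f z ^ 2 = ∑ j, Xvf B j f z ^ 2 :=
  Real.sq_sqrt (Finset.sum_nonneg fun _ _ => sq_nonneg _)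

lemma cs_abs (f g : (Fin n₁ → ℝ) × (Fin n → ℝ) → ℝ) (z : (Fin n₁ → ℝ) × (Fin n → ℝ)) :
    |∑ j, Xvf B j f z * Xvf B j g z| ≤ gradLen B f z * gradLen B g z := by
  rw [abs_le']
  refine ⟨Real.sum_mul_le_sqrt_mul_sqrt _ _ _, ?_⟩
  have := Real.sum_mul_le_sqrt_mul_sqrt Finset.univ (fun j => -Xvf B j f z) fun j => Xvf B j g z
  simpa [gradLen, gradSq, Finset.sum_neg_distrib] using this

lemma sFun_nonneg (hN : IsHomQuasiNorm2 N) (j₀ : Fin n₁) (z : (Fin n₁ → ℝ) × (Fin n → ℝ)) :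
    0 ≤ sFun N j₀ z := by
  have := hN.2.1 z
  have := Real.smoothTransition.nonneg (N z - 1)
  unfold sFun; positivity

lemma sFun_le (hN : IsHomQuasiNorm2 N) (j₀ : Fin n₁) {C : ℝ} (hC : 0 < C)
    {z : (Fin n₁ → ℝ) × (Fin n → ℝ)} (h : |z.1 j₀| ≤ C * N z) :
    sFun N j₀ z ≤ C ^ 2 * N z := by
  have h0 := hN.2.1 z
  have h1 : z.1 j₀ ^ 2 ≤ (C * N z) ^ 2 := by rw [← sq_abs]; gcongr
  unfold sFun
  calc _ ≤ 1 * (z.1 j₀ ^ 2 * (N z)⁻¹) := by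
        gcongr; exact Real.smoothTransition.le_one _
    _ ≤ 1 * ((C * N z) ^ 2 * (N z)⁻¹) := by gcongr
    _ = _ := by
      rcases h0.eq_or_lt with h | h
      · rw [← h]; simp
      · field_simp

lemma weight_le (hN : IsHomQuasiNorm2 N) (j₀ : Fin n₁) {C : ℝ} (hC : 0 < C)
    {z : (Fin n₁ → ℝ) × (Fin n → ℝ)} (h : |z.1 j₀| ≤ C * N z)
    (γ : ℕ) (hγ : 2 ≤ γ) (c : ℝ) (hc : 0 < c)
    (hG : z ≠ 0 → c * |z.1 j₀| ^ (γ - 1) / N z ^ (γ - 1) ≤ gradLen B N z)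
    (p : ℝ) (hp : 2 * (γ : ℝ) ≤ p) :
    N z ^ (p - 2 * (γ : ℝ)) * |z.1 j₀| ^ (2 * γ) ≤
      (c ^ 2)⁻¹ * (N z ^ (p - 1) * (sFun N j₀ z * gradLen B N z ^ 2)) +
        2 ^ (p - 2 * (γ : ℝ)) * (C * 2) ^ (2 * γ) := by
  have h0 := hN.2.1 z
  have hs := sFun_nonneg hN j₀ z
  by_cases hz : N z ≤ 2
  · have : N z ^ (p - 2 * (γ : ℝ)) * |z.1 j₀| ^ (2 * γ) ≤
        2 ^ (p - 2 * (γ : ℝ)) * (C * 2) ^ (2 * γ) := by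
      gcongr
      exact h.trans (by gcongr)
    have : 0 ≤ (c ^ 2)⁻¹ * (N z ^ (p - 1) * (sFun N j₀ z * gradLen B N z ^ 2)) := by positivity
    linarith
  · push Not at hz
    have hz0 : z ≠ 0 := by
      rintro rfl
      rw [(hN.2.2.1 0).2 rfl] at hz; norm_num at hz
    have hp0 : 0 < N z := by linarith
    have hg := hG hz0
    have hg2 : (c * |z.1 j₀| ^ (γ - 1) / N z ^ (γ - 1)) ^ 2 ≤ gradLen B N z ^ 2 := by gcongr
    have : N z ^ (p - 2 * (γ : ℝ)) * |z.1 j₀| ^ (2 * γ) ≤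
        (c ^ 2)⁻¹ * (N z ^ (p - 1) * (sFun N j₀ z * gradLen B N z ^ 2)) := by
      calc N z ^ (p - 2 * (γ : ℝ)) * |z.1 j₀| ^ (2 * γ) = (c ^ 2)⁻¹ * (N z ^ (p - 1) *
            (sFun N j₀ z * (c * |z.1 j₀| ^ (γ - 1) / N z ^ (γ - 1)) ^ 2)) := by
            obtain ⟨m, rfl⟩ : ∃ m, γ = m + 1 := ⟨γ - 1, by omega⟩
            have e : N z ^ (p - 1) = N z ^ (p - 2 * ((m + 1 : ℕ) : ℝ)) * N z ^ (2 * m + 1) := by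
              rw [← Real.rpow_natCast, ← Real.rpow_add hp0]
              congr 1; push_cast; ring
            rw [sFun, Real.smoothTransition.one_of_one_le (by linarith), e, ← sq_abs (z.1 j₀)]
            simp only [Nat.add_sub_cancel]
            field_simp
            ring
        _ ≤ _ := by gcongr
    have : 0 ≤ (2:ℝ) ^ (p - 2 * (γ : ℝ)) * (C * 2) ^ (2 * γ) := by positivity
    linarith

end

/-- U-bound (Lemma 3.4 of the paper, on step-2 groups): if the quasi-norm `N` satisfies the
gradient condition `|∇_G N(z)| ≥ c |x_{j₀}|^{γ−1}/N(z)^{γ−1}`, then for `p ≥ 2γ` and `q`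
the conjugate exponent of `p` there are `A > 0`, `B ≥ 0` such that for all smooth compactly
supported `f`:
`∫ |f|^q N^{p−2γ} |x_{j₀}|^{2γ} dμ_p ≤ A ∫ |∇_G f|^q dμ_p + B ∫ |f|^q dμ_p`. -/
theorem Ubound_step2
    (n₁ n : ℕ) (hn₁ : 0 < n₁) (hn : 0 < n)
    (B : Fin n → Matrix (Fin n₁) (Fin n₁) ℝ)
    (hskew : ∀ k, (B k)ᵀ = -(B k))
    (hindep : ∀ τ : Fin n → ℝ, ∑ k, τ k • B k = 0 → τ = 0)
    (N : (Fin n₁ → ℝ) × (Fin n → ℝ) → ℝ) (hN : IsHomQuasiNorm2 N)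
    (hsm : ContDiffOn ℝ (⊤ : ℕ∞) N {(0 : (Fin n₁ → ℝ) × (Fin n → ℝ))}ᶜ)
    (j₀ : Fin n₁) (γ : ℕ) (hγ : 2 ≤ γ) (c : ℝ) (hc : 0 < c)
    (hG : ∀ z : (Fin n₁ → ℝ) × (Fin n → ℝ), z ≠ 0 →
      c * |z.1 j₀| ^ (γ - 1) / N z ^ (γ - 1) ≤ gradLen B N z)
    (a p q : ℝ) (ha : 0 < a) (hp : 2 * (γ : ℝ) ≤ p) (hq : q = p / (p - 1)) :
    ∃ A : ℝ, 0 < A ∧ ∃ B₀ : ℝ, 0 ≤ B₀ ∧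
      ∀ f : (Fin n₁ → ℝ) × (Fin n → ℝ) → ℝ, ContDiff ℝ (⊤ : ℕ∞) f → HasCompactSupport f →
        ∫ z, |f z| ^ q * N z ^ (p - 2 * (γ : ℝ)) * |z.1 j₀| ^ (2 * γ) ∂(muP N a p) ≤
          A * ∫ z, gradLen B f z ^ q ∂(muP N a p) +
            B₀ * ∫ z, |f z| ^ q ∂(muP N a p) := by
  have hγ' : (2:ℝ) ≤ γ := by exact_mod_cast hγ
  have hp4 : 4 ≤ p := by linarith
  have hpq : p.HolderConjugate q := (Real.holderConjugate_iff_eq_conjExponent (by linarith)).2 hq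
  have hqp := hpq.symm
  have hq1 : 1 < q := hqp.lt
  have hq0 : 0 < q := hqp.pos
  obtain ⟨C, hC, hCz⟩ := coord_bdd hN
  have hCx : ∀ z : (Fin n₁ → ℝ) × (Fin n → ℝ), |z.1 j₀| ≤ C * N z := fun z =>
    (norm_le_pi_norm z.1 j₀).trans (hCz z).1
  obtain ⟨K, hK, hKz⟩ := XN_bdd (B := B) hN hsm
  choose D hD hDz using fun j => XU_bdd (B := B) hN hsm j₀ j
  set D₁ := ∑ j, D j with hD₁
  have hD₁0 : 0 ≤ D₁ := Finset.sum_nonneg fun j _ => (hD j).le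
  set C₂ := (C ^ 2) ^ (p - 1) * K ^ (p - 2) with hC₂
  have hC₂0 : 0 < C₂ := by positivity
  obtain ⟨δ, hδ, hδ1⟩ : ∃ δ : ℝ, 0 < δ ∧ q / p * δ ^ p * C₂ = a * p / 2 := by
    refine ⟨(a * p / 2 / (q / p * C₂)) ^ (p⁻¹), by positivity, ?_⟩
    rw [Real.rpow_inv_rpow (by positivity) (by positivity)]
    field_simp
  set E := (2:ℝ) ^ (p - 2 * (γ : ℝ)) * (C * 2) ^ (2 * γ) with hE
  have hE0 : 0 ≤ E := by positivity
  set κ := 2 / (a * p) * (c ^ 2)⁻¹ with hκ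
  have hκ0 : 0 < κ := by positivity
  refine ⟨κ * (δ ^ q)⁻¹, by positivity, κ * D₁ + E, by positivity, ?_⟩
  intro f hf hfs
  have hf1 : ContDiff ℝ 1 f := hf.of_le (by exact_mod_cast le_top)
  have key : ∀ z, |f z| ^ q * N z ^ (p - 2 * (γ : ℝ)) * |z.1 j₀| ^ (2 * γ) *
        Real.exp (-(a * N z ^ p)) ≤
      κ * (-∑ j, Xvf B j (HFun B N j₀ a p q f j) z) +
      (κ * (δ ^ q)⁻¹ * (gradLen B f z ^ q * Real.exp (-(a * N z ^ p))) +
        (κ * D₁ + E) * (|f z| ^ q * Real.exp (-(a * N z ^ p)))) := by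
    intro z
    have h0 := hN.2.1 z
    have hs := sFun_nonneg hN j₀ z
    have hW := weight_le (B := B) hN j₀ hC (hCx z) γ hγ c hc (hG z) p hp
    rw [← hE] at hW
    set w := Real.exp (-(a * N z ^ p)) with hw
    have hw0 : 0 < w := Real.exp_pos _
    set s := sFun N j₀ z with hs'
    set T := N z ^ (p - 1) * (s * gradLen B N z ^ 2) with hT
    have hgf := gradLen_nonneg (B := B) f z
    have hgN := gradLen_nonneg (B := B) N z
    have hfq : 0 ≤ |f z| ^ q := by positivity
    -- the identity for the divergence
    have hsum : ∑ j, Xvf B j (HFun B N j₀ a p q f j) z =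
        (q * |f z| ^ (q - 2) * f z * (s * ∑ j, Xvf B j f z * Xvf B j N z) +
        |f z| ^ q * ∑ j, Xvf B j (UFun B N j₀ j) z - a * p * |f z| ^ q * T) * w := by
      rw [hT, gradLen_sq]
      simp only [XH_eq hN hsm j₀ _ a p q hq1 hf1 z, ← Finset.sum_mul, Finset.sum_sub_distrib,
        Finset.sum_add_distrib, ← Finset.mul_sum]
      ring
    have hDb : |∑ j, Xvf B j (UFun B N j₀ j) z| ≤ D₁ :=
      (Finset.abs_sum_le_sum_abs _ _).trans (Finset.sum_le_sum fun j _ => hDz j z)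
    have habs : |q * |f z| ^ (q - 2) * f z| = q * |f z| ^ (q - 1) := by
      rw [abs_mul, abs_mul, abs_of_pos hq0, abs_of_nonneg (by positivity : 0 ≤ |f z| ^ (q - 2)),
        mul_assoc]
      congr 1
      rcases (abs_nonneg (f z)).eq_or_lt with h | h
      · rw [← h, mul_zero, Real.zero_rpow (by linarith)]
      · rw [← Real.rpow_add_one h.ne']; congr 1; ring
    have hA : |q * |f z| ^ (q - 2) * f z * (s * ∑ j, Xvf B j f z * Xvf B j N z)| ≤
        q * |f z| ^ (q - 1) * (gradLen B f z * (s * gradLen B N z)) := by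
      rw [abs_mul, habs, abs_mul, abs_of_nonneg hs]
      calc _ ≤ q * |f z| ^ (q - 1) * (s * (gradLen B f z * gradLen B N z)) := by
            gcongr; exact cs_abs f N z
        _ = _ := by ring
    have hY := young_pt (abs_nonneg (f z)) hgf (mul_nonneg hs hgN) hδ hqp
    have hU : (s * gradLen B N z) ^ p ≤ C₂ * T := by
      by_cases hz : z = 0
      · have : s = 0 := by rw [hs', hz]; exact (s_zero hN j₀).self_of_nhds
        rw [hT, this]
        simp [Real.zero_rpow (by linarith : p ≠ 0)]
      · exact upow_bound hs hgN h0 (by positivity) (sFun_le hN j₀ hC (hCx z)) (hKz z hz)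
          (by linarith)
    have hY2 : (q / p * δ ^ p) * (|f z| ^ q * (s * gradLen B N z) ^ p) ≤
        a * p / 2 * (|f z| ^ q * T) := by
      calc _ ≤ (q / p * δ ^ p) * (|f z| ^ q * (C₂ * T)) := by gcongr
        _ = (q / p * δ ^ p * C₂) * (|f z| ^ q * T) := by ring
        _ = _ := by rw [hδ1]
    have hB : |f z| ^ q * ∑ j, Xvf B j (UFun B N j₀ j) z ≤ |f z| ^ q * D₁ := by
      gcongr; exact (le_abs_self _).trans hDb
    have hP : a * p / 2 * (|f z| ^ q * T) ≤
        -(q * |f z| ^ (q - 2) * f z * (s * ∑ j, Xvf B j f z * Xvf B j N z) +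
        |f z| ^ q * ∑ j, Xvf B j (UFun B N j₀ j) z - a * p * |f z| ^ q * T) +
        (δ ^ q)⁻¹ * gradLen B f z ^ q + D₁ * |f z| ^ q := by
      have := (le_abs_self _).trans hA
      linarith
    have hP2 : |f z| ^ q * ((c ^ 2)⁻¹ * T) ≤ κ * (
        -(q * |f z| ^ (q - 2) * f z * (s * ∑ j, Xvf B j f z * Xvf B j N z) +
        |f z| ^ q * ∑ j, Xvf B j (UFun B N j₀ j) z - a * p * |f z| ^ q * T) +
        (δ ^ q)⁻¹ * gradLen B f z ^ q + D₁ * |f z| ^ q) := by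
      calc |f z| ^ q * ((c ^ 2)⁻¹ * T) = κ * (a * p / 2 * (|f z| ^ q * T)) := by
            rw [hκ]; field_simp
        _ ≤ _ := by gcongr
    rw [hsum]
    calc |f z| ^ q * N z ^ (p - 2 * (γ : ℝ)) * |z.1 j₀| ^ (2 * γ) * w
        = |f z| ^ q * (N z ^ (p - 2 * (γ : ℝ)) * |z.1 j₀| ^ (2 * γ)) * w := by ring
      _ ≤ |f z| ^ q * ((c ^ 2)⁻¹ * T + E) * w := by gcongr
      _ = (|f z| ^ q * ((c ^ 2)⁻¹ * T) + |f z| ^ q * E) * w := by ring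
      _ ≤ (κ * (
        -(q * |f z| ^ (q - 2) * f z * (s * ∑ j, Xvf B j f z * Xvf B j N z) +
        |f z| ^ q * ∑ j, Xvf B j (UFun B N j₀ j) z - a * p * |f z| ^ q * T) +
        (δ ^ q)⁻¹ * gradLen B f z ^ q + D₁ * |f z| ^ q) + |f z| ^ q * E) * w := by gcongr
      _ = _ := by ring
  -- integrability
  have hv := vol_haar n₁ n
  have hwc : Continuous fun z => Real.exp (-(a * N z ^ p)) :=
    (continuous_const.mul (hN.1.rpow_const fun _ => Or.inr (by linarith))).neg.rexp
  have hfc : Continuous fun z => |f z| ^ q := hf.continuous.abs.rpow_const fun _ => Or.inr hq0.le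
  have hf0 : ∀ z, z ∉ tsupport f → |f z| ^ q = 0 := by
    intro z hz
    rw [image_eq_zero_of_notMem_tsupport hz, abs_zero, Real.zero_rpow hq0.ne']
  have hint : ∀ g : (Fin n₁ → ℝ) × (Fin n → ℝ) → ℝ, Continuous g →
      (∀ z, z ∉ tsupport f → g z = 0) → Integrable g := by
    intro g hg hg0
    refine hg.integrable_of_hasCompactSupport (hfs.mono' fun z hz => ?_)
    by_contra h
    exact hz (hg0 z h)
  have hI1 : Integrable fun z => |f z| ^ q * N z ^ (p - 2 * (γ : ℝ)) * |z.1 j₀| ^ (2 * γ) *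
      Real.exp (-(a * N z ^ p)) := by
    refine hint _ ?_ fun z hz => by rw [hf0 z hz]; simp
    have h1 : Continuous fun z => N z ^ (p - 2 * (γ : ℝ)) :=
      hN.1.rpow_const fun _ => Or.inr (by linarith)
    fun_prop
  have hI2 : Integrable fun z => gradLen B f z ^ q * Real.exp (-(a * N z ^ p)) := by
    refine hint _ ?_ fun z hz => by rw [grad_supp hz, Real.zero_rpow hq0.ne', zero_mul]
    have h1 : Continuous (gradLen B f) := by
      have := fun j => Xvf_continuous B j hf1
      unfold gradLen gradSq
      fun_prop
    exact (h1.rpow_const fun _ => Or.inr hq0.le).mul hwc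
  have hI3 : Integrable fun z => |f z| ^ q * Real.exp (-(a * N z ^ p)) :=
    hint _ (hfc.mul hwc) fun z hz => by rw [hf0 z hz]; simp
  have hH : ∀ j, Integrable (Xvf B j (HFun B N j₀ a p q f j)) ∧
      ∫ z, Xvf B j (HFun B N j₀ a p q f j) z = 0 := fun j =>
    Xvf_integral B j (HFun_cd hN hsm j₀ j a p q hq1 hf1) (hfs.mono' fun z hz => by
      by_contra h
      exact hz (by simp only [HFun, hf0 z h, zero_mul]))
  have hHs : Integrable fun z => ∑ j, Xvf B j (HFun B N j₀ a p q f j) z :=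
    integrable_finsetSum _ fun j _ => (hH j).1
  have hHi : ∫ z, ∑ j, Xvf B j (HFun B N j₀ a p q f j) z = 0 := by
    rw [integral_finsetSum _ fun j _ => (hH j).1]
    exact Finset.sum_eq_zero fun j _ => (hH j).2
  have hJ1 : Integrable fun z => κ * (-∑ j, Xvf B j (HFun B N j₀ a p q f j) z) :=
    hHs.neg.const_mul κ
  have hJ2 := hI2.const_mul (κ * (δ ^ q)⁻¹)
  have hJ3 := hI3.const_mul (κ * D₁ + E)
  have hJ4 : Integrable fun z => κ * (δ ^ q)⁻¹ * (gradLen B f z ^ q * Real.exp (-(a * N z ^ p))) +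
      (κ * D₁ + E) * (|f z| ^ q * Real.exp (-(a * N z ^ p))) := hJ2.add hJ3
  have hfin := integral_mono hI1 (hJ1.add hJ4) key
  simp only [Pi.add_apply] at hfin
  rw [integral_add hJ1 hJ4, integral_add hJ2 hJ3,
    integral_const_mul, integral_const_mul, integral_const_mul, integral_neg, hHi, neg_zero,
    mul_zero, zero_add] at hfin
  have hp0 : 0 ≤ p := by linarith
  rw [integral_muP N hN.1 a p hp0, integral_muP N hN.1 a p hp0, integral_muP N hN.1 a p hp0]
  set Z := ((∫⁻ z, ENNReal.ofReal (Real.exp (-(a * N z ^ p))))⁻¹).toReal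
  have hZ : 0 ≤ Z := ENNReal.toReal_nonneg
  calc _ ≤ Z * _ := mul_le_mul_of_nonneg_left hfin hZ
    _ = _ := by ring
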